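/- arXiv:1202.2687 — 4 statements merged into one kernel-verified Lean document; each statement's English description precedes it below -/
import Mathlib

section
/- Let Y be a real-valued random variable whose law has a density f with respect to Lebesgue measure. For each m ∈ ℕ, let U_m be uniformly distributed on the interval (−2^{−(m+1)}, 2^{−(m+1)}), independent of Y, and set Ỹ_m = 2^{−m}·⌊2^m·Y⌋ + U_m. Then for each m the law of Ỹ_m is absolutely continuous with respect to Lebesgue measure, and there exist densities f_m of Ỹ_m (m ∈ ℕ) such that f_m(y) → f(y) as m → ∞ for Lebesgue-almost every y ∈ ℝ. -/
open MeasureTheory ProbabilityTheory Filter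

/-- The sum of `X` and an independent `U` with density `g` has density `y ↦ 𝔼[g (y - X)]`. -/
theorem map_add_eq_withDensity {Ω : Type*} {mΩ : MeasurableSpace Ω} {P : Measure Ω}
    [IsProbabilityMeasure P] {X U : Ω → ℝ} (hX : Measurable X) (hU : Measurable U)
    (hXU : IndepFun X U P) {g : ℝ → ENNReal} (hg : Measurable g)
    (hlaw : P.map U = volume.withDensity g) :
    P.map (fun ω => X ω + U ω) = volume.withDensity (fun y => ∫⁻ x, g (y - x) ∂(P.map X)) := by
  have := Measure.isProbabilityMeasure_map (μ := P) hX.aemeasurable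
  have := Measure.isProbabilityMeasure_map (μ := P) hU.aemeasurable
  have hprod := (indepFun_iff_map_prod_eq_prod_map_map hX.aemeasurable hU.aemeasurable).1 hXU
  refine Measure.ext_of_lintegral _ fun φ hφ => ?_
  have hkernel : Measurable fun p : ℝ × ℝ => g (p.2 - p.1) * φ p.2 := by fun_prop
  calc ∫⁻ z, φ z ∂(P.map fun ω => X ω + U ω)
      = ∫⁻ p, φ (p.1 + p.2) ∂(P.map fun ω => (X ω, U ω)) := by
        rw [lintegral_map hφ (by fun_prop), lintegral_map (by fun_prop) (by fun_prop)]
    _ = ∫⁻ x, ∫⁻ u, φ (x + u) ∂(P.map U) ∂(P.map X) := by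
        rw [hprod, lintegral_prod _ (by fun_prop)]
    _ = ∫⁻ x, (∫⁻ y, g (y - x) * φ y) ∂(P.map X) := by
        refine lintegral_congr fun x => ?_
        rw [hlaw, lintegral_withDensity_eq_lintegral_mul _ hg (by fun_prop),
          ← lintegral_sub_right_eq_self _ x]
        simp
    _ = ∫⁻ y, ∫⁻ x, g (y - x) * φ y ∂(P.map X) := lintegral_lintegral_swap hkernel.aemeasurable
    _ = ∫⁻ z, φ z ∂(volume.withDensity fun y => ∫⁻ x, g (y - x) ∂(P.map X)) := by
        have hdens : Measurable fun y => ∫⁻ x, g (y - x) ∂(P.map X) :=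
          Measurable.lintegral_prod_left' (f := fun p : ℝ × ℝ => g (p.2 - p.1)) (by fun_prop)
        rw [lintegral_withDensity_eq_lintegral_mul _ hdens hφ]
        exact lintegral_congr fun y => lintegral_mul_const _ (by fun_prop)

/-- `y` lies within half a mesh of the quantization of `x` on the grid `s⁻¹ ℤ` exactly when that
quantization is the grid point nearest to `y`. -/
theorem sub_floor_div_mem_Ico_iff {s : ℝ} (hs : 0 < s) (x y : ℝ) :
    y - s⁻¹ * (⌊s * x⌋ : ℤ) ∈ Set.Ico (-(s⁻¹ / 2)) (s⁻¹ / 2) ↔ ⌊s * x⌋ = ⌊s * y + 1 / 2⌋ := by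
  rw [eq_comm, Int.floor_eq_iff, Set.mem_Ico,
    ← mul_le_mul_iff_right₀ hs, ← mul_lt_mul_iff_right₀ hs]
  field_simp
  constructor <;> rintro ⟨h₁, h₂⟩ <;> constructor <;> linarith

theorem setOf_floor_mul_eq {s : ℝ} (hs : 0 < s) (k : ℤ) :
    {x : ℝ | ⌊s * x⌋ = k} = Set.Ico (s⁻¹ * k) (s⁻¹ * k + s⁻¹) := by
  ext x
  rw [Set.mem_ofPred_eq, Int.floor_eq_iff, Set.mem_Ico,
    ← mul_le_mul_iff_right₀ (b := s⁻¹ * k) hs, ← mul_lt_mul_iff_right₀ (b := x) hs,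
    mul_add, mul_inv_cancel_left₀ hs.ne', mul_inv_cancel₀ hs.ne']

theorem setOf_floor_mul_ae_eq_closedBall {s : ℝ} (hs : 0 < s) (k : ℤ) :
    {x : ℝ | ⌊s * x⌋ = k} =ᵐ[volume] Metric.closedBall (s⁻¹ * (k + 1 / 2)) (s⁻¹ / 2) := by
  rw [setOf_floor_mul_eq hs, Real.closedBall_eq_Icc]
  have h₁ : s⁻¹ * (k + 1 / 2) - s⁻¹ / 2 = s⁻¹ * k := by ring
  have h₂ : s⁻¹ * (k + 1 / 2) + s⁻¹ / 2 = s⁻¹ * k + s⁻¹ := by ring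
  rw [h₁, h₂]
  exact Ico_ae_eq_Icc

theorem lintegral_indicator_sub_floor_div {s : ℝ} (hs : 0 < s) (μ : Measure ℝ) (y : ℝ) :
    ∫⁻ x, (Set.Ico (-(s⁻¹ / 2)) (s⁻¹ / 2)).indicator (fun _ => (ENNReal.ofReal s⁻¹)⁻¹)
      (y - s⁻¹ * (⌊s * x⌋ : ℤ)) ∂μ =
      μ {x | ⌊s * x⌋ = ⌊s * y + 1 / 2⌋} / ENNReal.ofReal s⁻¹ := by
  have hS : MeasurableSet {x : ℝ | ⌊s * x⌋ = ⌊s * y + 1 / 2⌋} := by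
    rw [setOf_floor_mul_eq hs]; exact measurableSet_Ico
  rw [ENNReal.div_eq_inv_mul, ← lintegral_indicator_const hS]
  refine lintegral_congr fun x => ?_
  simp only [Set.indicator_apply, sub_floor_div_mem_Ico_iff hs, Set.mem_ofPred_eq]

/-- **Lebesgue differentiation** along the cells of grids of vanishing mesh. -/
theorem ae_tendsto_floor_cell_density {h : ℝ → ENNReal} (hh : Measurable h)
    (hfin : ∫⁻ x, h x ≠ ⊤) {s : ℕ → ℝ} (hs : ∀ m, 0 < s m) (hlim : Tendsto s atTop atTop) :
    ∀ᵐ y, Tendsto (fun m => volume.withDensity h {x | ⌊s m * x⌋ = ⌊s m * y + 1 / 2⌋} /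
      ENNReal.ofReal (s m)⁻¹) atTop (nhds (h y)) := by
  filter_upwards [(IsUnifLocDoublingMeasure.vitaliFamily (volume : Measure ℝ) 2
    ).ae_tendsto_lintegral_div' hh hfin] with y hy
  have hδ : Tendsto (fun m => (s m)⁻¹ / 2) atTop (nhdsWithin 0 (Set.Ioi 0)) := by
    refine tendsto_nhdsWithin_iff.2 ⟨?_, Eventually.of_forall fun m => ?_⟩
    · simpa using hlim.inv_tendsto_atTop.div_const 2
    · have := hs m
      exact Set.mem_Ioi.2 (by positivity)
  refine (hy.comp (IsUnifLocDoublingMeasure.tendsto_closedBall_filterAt volume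
    (fun m => (s m)⁻¹ * ((⌊s m * y + 1 / 2⌋ : ℤ) + 1 / 2)) _ hδ
    (Eventually.of_forall fun m => ?_))).congr fun m => ?_
  · have := hs m
    have h₁ := Int.floor_le (s m * y + 1 / 2)
    have h₂ := Int.lt_floor_add_one (s m * y + 1 / 2)
    generalize (⌊s m * y + 1 / 2⌋ : ℤ) = k at h₁ h₂ ⊢
    rw [Real.closedBall_eq_Icc, Set.mem_Icc, ← mul_le_mul_iff_right₀ this,
      ← mul_le_mul_iff_right₀ this]
    field_simp
    constructor <;> linarith
  · have hae := setOf_floor_mul_ae_eq_closedBall (hs m) ⌊s m * y + 1 / 2⌋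
    rw [measure_congr ((withDensity_absolutelyContinuous volume h).ae_eq hae),
      withDensity_apply _ measurableSet_closedBall]
    simp [Real.volume_closedBall, mul_div_cancel₀]

/-- **Quantize-and-dither densities converge.** If `Y` has density `f`, `U m` is
uniform on `(-2^{-(m+1)}, 2^{-(m+1)})` and independent of `Y`, and
`Ỹ m = 2^{-m} ⌊2^m Y⌋ + U m`, then each `Ỹ m` has a density `f m`, and the densities
can be chosen so that `f m → f` pointwise Lebesgue-almost everywhere. -/
theorem stmt9 {Ω : Type*} [MeasureSpace Ω] [IsProbabilityMeasure (ℙ : Measure Ω)]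
    (Y : Ω → ℝ) (hY : Measurable Y)
    (f : ℝ → ℝ) (hf_meas : Measurable f) (hf_nonneg : ∀ᵐ x ∂(volume : Measure ℝ), 0 ≤ f x)
    (hf : Measure.map Y ℙ = volume.withDensity (fun x => ENNReal.ofReal (f x)))
    (U : ℕ → Ω → ℝ) (hU_meas : ∀ m, Measurable (U m))
    (hU : ∀ m, Measure.map (U m) ℙ =
      (volume (Set.Ioo (-(2 : ℝ) ^ (-((m : ℤ) + 1))) ((2 : ℝ) ^ (-((m : ℤ) + 1)))))⁻¹ •
        volume.restrict (Set.Ioo (-(2 : ℝ) ^ (-((m : ℤ) + 1))) ((2 : ℝ) ^ (-((m : ℤ) + 1)))))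
    (hindep : ∀ m, IndepFun Y (U m) ℙ)
    (Ytil : ℕ → Ω → ℝ)
    (hYtil : ∀ m ω, Ytil m ω = (2 : ℝ) ^ (-(m : ℤ)) * (⌊(2 : ℝ) ^ m * Y ω⌋ : ℤ) + U m ω) :
    (∀ m, Measure.map (Ytil m) ℙ ≪ (volume : Measure ℝ)) ∧
    ∃ fm : ℕ → ℝ → ℝ,
      (∀ m, Measure.map (Ytil m) ℙ = volume.withDensity (fun y => ENNReal.ofReal (fm m y))) ∧
      ∀ᵐ y ∂(volume : Measure ℝ), Tendsto (fun m => fm m y) atTop (nhds (f y)) := by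
  have hprob : IsProbabilityMeasure (Measure.map Y ℙ) :=
    Measure.isProbabilityMeasure_map hY.aemeasurable
  have hfin : ∫⁻ x, ENNReal.ofReal (f x) ≠ ⊤ := by
    have h := measure_ne_top (Measure.map Y ℙ) Set.univ
    rwa [hf, withDensity_apply _ MeasurableSet.univ, setLIntegral_univ] at h
  have hs : ∀ m : ℕ, (0 : ℝ) < 2 ^ m := fun m => by positivity
  have hlaw : ∀ m, Measure.map (U m) ℙ = volume.withDensity
      ((Set.Ico (-(((2 : ℝ) ^ m)⁻¹ / 2)) (((2 : ℝ) ^ m)⁻¹ / 2)).indicator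
        (fun _ => (ENNReal.ofReal ((2 : ℝ) ^ m)⁻¹)⁻¹)) := fun m => by
    have hpow : (2 : ℝ) ^ (-((m : ℤ) + 1)) = ((2 : ℝ) ^ m)⁻¹ / 2 := by
      rw [zpow_neg, zpow_add_one₀ two_ne_zero, zpow_natCast, mul_inv, div_eq_mul_inv]
    rw [hU m, hpow, withDensity_indicator measurableSet_Ico, withDensity_const,
      Real.volume_Ioo, sub_neg_eq_add, add_halves,
      Measure.restrict_congr_set Ioo_ae_eq_Ico]
  have hdens : ∀ m, Measure.map (Ytil m) ℙ = volume.withDensity (fun y => ENNReal.ofReal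
      (Measure.map Y ℙ {x | ⌊(2 : ℝ) ^ m * x⌋ = ⌊(2 : ℝ) ^ m * y + 1 / 2⌋} /
        ENNReal.ofReal ((2 : ℝ) ^ m)⁻¹).toReal) := fun m => by
    have hq : Measurable fun x : ℝ => ((2 : ℝ) ^ m)⁻¹ * (⌊(2 : ℝ) ^ m * x⌋ : ℤ) := by fun_prop
    have hY' : Ytil m = fun ω => ((2 : ℝ) ^ m)⁻¹ * (⌊(2 : ℝ) ^ m * Y ω⌋ : ℤ) + U m ω := by
      ext ω
      rw [hYtil, zpow_neg, zpow_natCast]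
    have hg : Measurable ((Set.Ico (-(((2 : ℝ) ^ m)⁻¹ / 2)) (((2 : ℝ) ^ m)⁻¹ / 2)).indicator
        (fun _ => (ENNReal.ofReal ((2 : ℝ) ^ m)⁻¹)⁻¹)) :=
      measurable_const.indicator measurableSet_Ico
    rw [hY', map_add_eq_withDensity (X := fun ω => ((2 : ℝ) ^ m)⁻¹ * (⌊(2 : ℝ) ^ m * Y ω⌋ : ℤ))
      (hq.comp hY) (hU_meas m)
      ((hindep m).comp hq measurable_id) hg (hlaw m)]
    congr 1
    ext1 y
    rw [← Function.comp_def (fun x : ℝ => ((2 : ℝ) ^ m)⁻¹ * (⌊(2 : ℝ) ^ m * x⌋ : ℤ)) Y,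
      ← Measure.map_map hq hY, lintegral_map (by fun_prop) hq, lintegral_indicator_sub_floor_div (hs m),
      ENNReal.ofReal_toReal]
    exact ENNReal.div_ne_top (measure_ne_top _ _) (by simp)
  refine ⟨fun m => hdens m ▸ withDensity_absolutelyContinuous _ _, _, hdens, ?_⟩
  filter_upwards [hf_nonneg, ae_tendsto_floor_cell_density hf_meas.ennreal_ofReal hfin hs
    (tendsto_pow_atTop_atTop_of_one_lt one_lt_two)] with y hy hlim
  rw [← hf] at hlim
  have := (ENNReal.tendsto_toReal ENNReal.ofReal_ne_top).comp hlim
  rwa [ENNReal.toReal_ofReal hy] at this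
end

section
/- Let F : ℝ → ℝ be nondecreasing and differentiable at a point y with F'(y) = c. Let (a_m)_{m∈ℕ} be a real sequence satisfying y − 2^{−(m+1)} ≤ a_m < y + 2^{−(m+1)} for every m. Then 2^m · (F(a_m + 2^{−m}) − F(a_m)) → c as m → ∞. -/
open Filter

/-- First-order expansion of `F` between two points approaching the point of differentiability
at a common rate `r`. -/
theorem HasDerivAt.isLittleO_sub_of_isBigO {ι : Type*} {l : Filter ι} {F : ℝ → ℝ} {c y : ℝ}
    (hF : HasDerivAt F c y) {u v r : ι → ℝ} (hr : Tendsto r l (nhds 0))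
    (hu : (fun i => u i - y) =O[l] r) (hv : (fun i => v i - y) =O[l] r) :
    (fun i => F (u i) - F (v i) - (u i - v i) * c) =o[l] r := by
  have key : ∀ w : ι → ℝ, (fun i => w i - y) =O[l] r →
      (fun i => F (w i) - F y - (w i - y) * c) =o[l] r := by
    intro w hw
    have hwy : Tendsto w l (nhds y) := tendsto_sub_nhds_zero_iff.mp (hw.trans_tendsto hr)
    have h := (hasDerivAt_iff_isLittleO.mp hF).comp_tendsto hwy
    exact h.trans_isBigO hw
  refine ((key u hu).sub (key v hv)).congr_left fun i => ?_
  ring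

/-- If `F` is nondecreasing and differentiable at `y` with `F'(y) = c`, and
`y - 2^{-(m+1)} ≤ a m < y + 2^{-(m+1)}` for all `m`, then
`2^m (F (a m + 2^{-m}) - F (a m)) → c`. -/
theorem stmt10 (F : ℝ → ℝ) (y c : ℝ) (hmono : Monotone F) (hderiv : HasDerivAt F c y)
    (a : ℕ → ℝ)
    (ha : ∀ m : ℕ, y - (2 : ℝ) ^ (-((m : ℤ) + 1)) ≤ a m ∧ a m < y + (2 : ℝ) ^ (-((m : ℤ) + 1))) :
    Tendsto (fun m : ℕ => (2 : ℝ) ^ m * (F (a m + (2 : ℝ) ^ (-(m : ℤ))) - F (a m)))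
      atTop (nhds c) := by
  have hpow (m : ℕ) : (2 : ℝ) ^ (-(m : ℤ)) = (1 / 2) ^ m := by simp
  have hpow' (m : ℕ) : (2 : ℝ) ^ (-((m : ℤ) + 1)) = (1 / 2) ^ m / 2 := by
    rw [neg_add, zpow_add₀ two_ne_zero, hpow, zpow_neg_one, ← div_eq_mul_inv]
  simp only [hpow, hpow'] at ha ⊢
  have hr : Tendsto (fun m : ℕ => (1 / 2 : ℝ) ^ m) atTop (nhds 0) :=
    tendsto_pow_atTop_nhds_zero_of_lt_one (by norm_num) (by norm_num)
  have hv : (fun m => a m - y) =O[atTop] fun m : ℕ => (1 / 2 : ℝ) ^ m := by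
    refine Asymptotics.isBigO_of_le _ fun m => ?_
    have hpos : (0 : ℝ) < (1 / 2) ^ m := by positivity
    rw [Real.norm_eq_abs, Real.norm_of_nonneg hpos.le, abs_le]
    constructor <;> linarith [(ha m).1, (ha m).2]
  have hu : (fun m => a m + (1 / 2) ^ m - y) =O[atTop] fun m : ℕ => (1 / 2 : ℝ) ^ m :=
    (hv.add (Asymptotics.isBigO_refl _ _)).congr_left fun m => by ring
  have h := (hderiv.isLittleO_sub_of_isBigO hr hu hv).tendsto_div_nhds_zero.add_const c
  rw [zero_add] at h
  refine h.congr fun m => ?_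
  have htwo : (2 : ℝ) ^ m * (1 / 2) ^ m = 1 := by rw [← mul_pow]; norm_num
  have hne : (1 / 2 : ℝ) ^ m ≠ 0 := by positivity
  rw [eq_div_of_mul_eq hne htwo, add_sub_cancel_left]
  field_simp
  ring
end

section
/- Let Y be a real-valued random variable whose law has a density f with respect to Lebesgue measure. Fix m ∈ ℕ, let U_m be uniformly distributed on the interval (−2^{−(m+1)}, 2^{−(m+1)}), independent of Y, and set Ỹ_m = 2^{−m}·⌊2^m·Y⌋ + U_m. For y ∈ ℝ define a_m(y) = 2^{−m}·⌈2^m·y − 1/2⌉. Then the function y ↦ 2^m · ∫_{a_m(y)}^{a_m(y) + 2^{−m}} f(x) dx is a density of Ỹ_m with respect to Lebesgue measure. -/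
open MeasureTheory ProbabilityTheory

/-- The uniform law on `Ioo (-h) h`, translated by `g`, evaluated on a measurable set. -/
lemma uniform_preimage_add (c h : ℝ) (hc : 0 < c) (hh : 2 * h = c⁻¹) (g : ℝ) (A : Set ℝ)
    (hA : MeasurableSet A) :
    ((volume (Set.Ioo (-h) h))⁻¹ • volume.restrict (Set.Ioo (-h) h)) ((fun u => g + u) ⁻¹' A) =
      ENNReal.ofReal c * volume (A ∩ Set.Ioc (g - h) (g + h)) := by
  have hvol : (volume (Set.Ioo (-h) h))⁻¹ = ENNReal.ofReal c := by
    rw [Real.volume_Ioo, show h - -h = c⁻¹ by linarith, ENNReal.ofReal_inv_of_pos hc, inv_inv]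
  rw [Measure.smul_apply, hvol, smul_eq_mul, Measure.restrict_congr_set Ioo_ae_eq_Ioc,
    Measure.restrict_apply (measurable_const_add g hA),
    ← measure_preimage_add volume g (A ∩ Set.Ioc (g - h) (g + h))]
  congr 2
  ext u
  simp only [Set.mem_inter_iff, Set.mem_preimage, Set.mem_Ioc]
  refine and_congr_right fun _ => ?_
  constructor <;> rintro ⟨h1, h2⟩ <;> constructor <;> linarith

lemma setOf_ceil_eq_Ioc (c h : ℝ) (hc : 0 < c) (hh : 2 * h = c⁻¹) (k : ℤ) :
    {z : ℝ | k = ⌈c * z - 1 / 2⌉} = Set.Ioc (c⁻¹ * k - h) (c⁻¹ * k + h) := by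
  have hch : c * h = 1 / 2 := by
    have : c * (2 * h) = 1 := by rw [hh, mul_inv_cancel₀ hc.ne']
    linarith
  have hck : c * (c⁻¹ * k) = k := by rw [← mul_assoc, mul_inv_cancel₀ hc.ne', one_mul]
  ext z
  rw [Set.mem_ofPred_eq, eq_comm, Int.ceil_eq_iff, Set.mem_Ioc,
    ← mul_lt_mul_iff_right₀ hc (b := c⁻¹ * k - h),
    ← mul_le_mul_iff_right₀ hc (c := c⁻¹ * k + h), mul_sub, mul_add, hck, hch]
  constructor <;> rintro ⟨h1, h2⟩ <;> constructor <;> linarith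

lemma setOf_floor_eq_Ico (c : ℝ) (hc : 0 < c) (k : ℤ) :
    {y : ℝ | ⌊c * y⌋ = k} = Set.Ico (c⁻¹ * k) (c⁻¹ * k + c⁻¹) := by
  have hck : c * (c⁻¹ * k) = k := by rw [← mul_assoc, mul_inv_cancel₀ hc.ne', one_mul]
  ext y
  rw [Set.mem_ofPred_eq, Int.floor_eq_iff, Set.mem_Ico,
    ← mul_lt_mul_iff_right₀ hc (c := c⁻¹ * k + c⁻¹),
    ← mul_le_mul_iff_right₀ hc (b := c⁻¹ * k), mul_add, hck, mul_inv_cancel₀ hc.ne']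

/-- The law of the quantization of a variable with law `μ`, dithered by an independent uniform
variable on `Ioo (-h) h`, where `2 * h = c⁻¹` is the quantization step. -/
lemma map_quantize_add_uniform (μ : Measure ℝ) [SFinite μ] (c h : ℝ) (hc : 0 < c)
    (hh : 2 * h = c⁻¹) :
    Measure.map (fun p : ℝ × ℝ => c⁻¹ * (⌊c * p.1⌋ : ℤ) + p.2)
      (μ.prod ((volume (Set.Ioo (-h) h))⁻¹ • volume.restrict (Set.Ioo (-h) h))) =
    volume.withDensity (fun z => ENNReal.ofReal c *
      μ (Set.Ico (c⁻¹ * (⌈c * z - 1 / 2⌉ : ℤ)) (c⁻¹ * (⌈c * z - 1 / 2⌉ : ℤ) + c⁻¹))) := by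
  have hmeas : Measurable (fun p : ℝ × ℝ => c⁻¹ * ((⌊c * p.1⌋ : ℤ) : ℝ) + p.2) := by fun_prop
  have hN : MeasurableSet {p : ℝ × ℝ | ⌊c * p.1⌋ = ⌈c * p.2 - 1 / 2⌉} :=
    measurableSet_eq_fun (by fun_prop) (by fun_prop)
  ext A hA
  calc _ = ∫⁻ y, ENNReal.ofReal c *
          volume.restrict A (Prod.mk y ⁻¹' {p : ℝ × ℝ | ⌊c * p.1⌋ = ⌈c * p.2 - 1 / 2⌉}) ∂μ := by
        rw [Measure.map_apply hmeas hA, Measure.prod_apply (hmeas hA)]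
        refine lintegral_congr fun y => ?_
        rw [Measure.restrict_apply (measurable_prodMk_left hN), Set.inter_comm]
        have := uniform_preimage_add c h hc hh (c⁻¹ * (⌊c * y⌋ : ℤ)) A hA
        rw [← setOf_ceil_eq_Ioc c h hc hh] at this
        exact this
    _ = ENNReal.ofReal c *
          (μ.prod (volume.restrict A)) {p : ℝ × ℝ | ⌊c * p.1⌋ = ⌈c * p.2 - 1 / 2⌉} := by
        rw [lintegral_const_mul _ (measurable_measure_prodMk_left hN), Measure.prod_apply hN]
    _ = _ := by
        rw [withDensity_apply _ hA, Measure.prod_apply_symm hN,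
          ← lintegral_const_mul _ (measurable_measure_prodMk_right hN)]
        refine lintegral_congr fun z => ?_
        rw [← setOf_floor_eq_Ico c hc]
        rfl

/-- **Explicit density of the quantized-and-dithered variable.** If `Y` has density `f`,
`U` is uniform on `(-2^{-(m+1)}, 2^{-(m+1)})` and independent of `Y`, and
`Ỹ = 2^{-m} ⌊2^m Y⌋ + U`, then `y ↦ 2^m ∫_{a_m(y)}^{a_m(y) + 2^{-m}} f`, with
`a_m(y) = 2^{-m} ⌈2^m y - 1/2⌉`, is a density of `Ỹ`. -/
theorem stmt11 {Ω : Type*} [MeasureSpace Ω] [IsProbabilityMeasure (ℙ : Measure Ω)]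
    (Y : Ω → ℝ) (hY : Measurable Y)
    (f : ℝ → ℝ) (hf_meas : Measurable f) (hf_nonneg : ∀ᵐ x ∂(volume : Measure ℝ), 0 ≤ f x)
    (hf : Measure.map Y ℙ = volume.withDensity (fun x => ENNReal.ofReal (f x)))
    (m : ℕ) (U : Ω → ℝ) (hU_meas : Measurable U)
    (hU : Measure.map U ℙ =
      (volume (Set.Ioo (-(2 : ℝ) ^ (-((m : ℤ) + 1))) ((2 : ℝ) ^ (-((m : ℤ) + 1)))))⁻¹ •
        volume.restrict (Set.Ioo (-(2 : ℝ) ^ (-((m : ℤ) + 1))) ((2 : ℝ) ^ (-((m : ℤ) + 1)))))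
    (hindep : IndepFun Y U ℙ)
    (Ytil : Ω → ℝ)
    (hYtil : ∀ ω, Ytil ω = (2 : ℝ) ^ (-(m : ℤ)) * (⌊(2 : ℝ) ^ m * Y ω⌋ : ℤ) + U ω)
    (am : ℝ → ℝ)
    (ham : ∀ y, am y = (2 : ℝ) ^ (-(m : ℤ)) * (⌈(2 : ℝ) ^ m * y - 1 / 2⌉ : ℤ)) :
    Measure.map Ytil ℙ = volume.withDensity
      (fun y => ENNReal.ofReal
        ((2 : ℝ) ^ m * ∫ x in (am y)..(am y + (2 : ℝ) ^ (-(m : ℤ))), f x)) := by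
  have hc : (0 : ℝ) < 2 ^ m := by positivity
  have hcinv : (2 : ℝ) ^ (-(m : ℤ)) = (2 ^ m)⁻¹ := by rw [zpow_neg, zpow_natCast]
  have hh : 2 * (2 : ℝ) ^ (-((m : ℤ) + 1)) = (2 ^ m)⁻¹ := by
    rw [← hcinv, neg_add, zpow_add₀ two_ne_zero]
    norm_num
    ring
  have : IsProbabilityMeasure (Measure.map Y ℙ) := Measure.isProbabilityMeasure_map hY.aemeasurable
  have hYU := (indepFun_iff_map_prod_eq_prod_map_map hY.aemeasurable hU_meas.aemeasurable).1 hindep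
  have hmeas : Measurable (fun p : ℝ × ℝ => ((2 : ℝ) ^ m)⁻¹ * ((⌊2 ^ m * p.1⌋ : ℤ) : ℝ) + p.2) := by
    fun_prop
  have hfun : Ytil = (fun p : ℝ × ℝ => ((2 : ℝ) ^ m)⁻¹ * ((⌊2 ^ m * p.1⌋ : ℤ) : ℝ) + p.2) ∘
      fun ω => (Y ω, U ω) := by
    funext ω
    simp [hYtil]
  have hint : Integrable f := by
    refine ⟨hf_meas.aestronglyMeasurable, ?_⟩
    rw [hasFiniteIntegral_iff_ofReal hf_nonneg, ← setLIntegral_univ,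
      ← withDensity_apply _ MeasurableSet.univ, ← hf]
    exact measure_lt_top _ _
  rw [hfun, ← Measure.map_map hmeas (hY.prodMk hU_meas), hYU, hU,
    map_quantize_add_uniform _ _ _ hc hh]
  congr 1
  funext z
  rw [ham, hcinv, ENNReal.ofReal_mul hc.le, hf, withDensity_apply _ measurableSet_Ico,
    intervalIntegral.integral_of_le (by simp), ← integral_Ico_eq_integral_Ioc,
    ofReal_integral_eq_lintegral_ofReal hint.integrableOn (ae_restrict_of_ae hf_nonneg)]
end

section
/- Let N ≥ 2 and b ≥ 1 be integers, let M be a finite set with |M| = N, and let ε ∈ [0, 1]. On a common probability space, let W = (W_1, ..., W_b) be a random vector whose components are i.i.d. uniform on M, and let Ŵ = (Ŵ_1, ..., Ŵ_b) be any M^b-valued random vector such that P(W_ℓ ≠ Ŵ_ℓ) ≤ ε for each ℓ ∈ {1, ..., b}. Then the mutual information satisfies I(W; Ŵ) ≥ b·((1 − ε)·log N − log 2). -/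
open MeasureTheory ProbabilityTheory
open scoped ENNReal

/-- Shannon entropy (natural logarithm) of a finitely-valued random variable. -/
noncomputable def shannonEntropy {Ω α : Type*} [MeasurableSpace Ω] [Fintype α]
    (μ : Measure Ω) (X : Ω → α) : ℝ :=
  - ∑ x : α, ((μ (X ⁻¹' {x})).toReal * Real.log (μ (X ⁻¹' {x})).toReal)

/-- The law of a finitely-valued random variable determines the probability of an event
depending on it. -/
theorem sum_indicator_mul_measureReal_preimage {Ω α : Type*} [MeasurableSpace Ω]
    [MeasurableSpace α] [MeasurableSingletonClass α] [Fintype α] (μ : Measure Ω)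
    [IsFiniteMeasure μ] {X : Ω → α} (hX : Measurable X) (p : α → Prop) [DecidablePred p] :
    ∑ x, μ.real (X ⁻¹' {x}) * (if p x then 1 else 0) = μ.real {ω | p (X ω)} := by
  simp only [mul_ite, mul_one, mul_zero, ← Finset.sum_filter]
  rw [sum_measureReal_preimage_singleton _ fun x _ => hX (measurableSet_singleton x)]
  congr 1
  ext ω
  simp

theorem sum_measureReal_preimage_prodMk {Ω α β : Type*} [MeasurableSpace Ω]
    [MeasurableSpace α] [MeasurableSingletonClass α] [Fintype α] (μ : Measure Ω)
    [IsFiniteMeasure μ] {X : Ω → α} (hX : Measurable X) (Y : Ω → β) (y : β) :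
    ∑ x, μ.real ((fun ω => (X ω, Y ω)) ⁻¹' {(x, y)}) = μ.real (Y ⁻¹' {y}) := by
  have h := sum_measureReal_preimage_singleton (μ := μ.restrict (Y ⁻¹' {y})) (f := X)
    Finset.univ fun x _ => hX (measurableSet_singleton x)
  simp only [Finset.coe_univ, Set.preimage_univ, measureReal_restrict_apply_univ] at h
  rw [← h]
  refine Finset.sum_congr rfl fun x _ => ?_
  rw [measureReal_restrict_apply (hX (measurableSet_singleton x))]
  congr 1
  ext ω
  simp

theorem mul_log_sub_mul_log_le_sub {p r : ℝ} (hp : 0 ≤ p) (hr : 0 ≤ r) (h : 0 < p → 0 < r) :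
    p * Real.log r - p * Real.log p ≤ r - p := by
  rcases hp.eq_or_lt with rfl | hp
  · simpa using hr
  · have hlog := Real.log_le_sub_one_of_pos (div_pos (h hp) hp)
    rw [Real.log_div (h hp).ne' hp.ne'] at hlog
    have := mul_le_mul_of_nonneg_left hlog hp.le
    have e : p * (r / p - 1) = r - p := by field_simp
    linarith

/-- Gibbs' inequality for conditional entropy: `H(X | Y) ≤ 𝔼[-log q(X | Y)]` for every
conditional sub-probability `q`. -/
theorem shannonEntropy_prodMk_le {Ω α β : Type*} [MeasurableSpace Ω]
    [MeasurableSpace α] [MeasurableSingletonClass α] [Fintype α] [Fintype β] (μ : Measure Ω)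
    [IsFiniteMeasure μ] {X : Ω → α} (hX : Measurable X) (Y : Ω → β)
    (q : α → β → ℝ) (hq : ∀ x y, 0 < q x y) (hsum : ∀ y, ∑ x, q x y ≤ 1) :
    shannonEntropy μ (fun ω => (X ω, Y ω)) ≤ shannonEntropy μ Y
      - ∑ z : α × β, μ.real ((fun ω => (X ω, Y ω)) ⁻¹' {z}) * Real.log (q z.1 z.2) := by
  simp only [shannonEntropy, ← measureReal_def, Fintype.sum_prod_type_right]
  set p : α → β → ℝ := fun x y => μ.real ((fun ω => (X ω, Y ω)) ⁻¹' {(x, y)})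
  set m : β → ℝ := fun y => μ.real (Y ⁻¹' {y})
  have hm : ∀ y, ∑ x, p x y = m y := sum_measureReal_preimage_prodMk μ hX Y
  have hp : ∀ x y, 0 ≤ p x y := fun _ _ => measureReal_nonneg
  have key : ∀ y, m y * Real.log (m y) + ∑ x, p x y * Real.log (q x y)
      - ∑ x, p x y * Real.log (p x y) ≤ 0 := by
    intro y
    have hpm : ∀ x, p x y ≤ m y := fun x => by
      rw [← hm y]
      exact Finset.single_le_sum (fun i _ => hp i y) (Finset.mem_univ x)
    have hm0 : 0 ≤ m y := measureReal_nonneg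
    have hterm : ∀ x, p x y * Real.log (m y) + p x y * Real.log (q x y)
        - p x y * Real.log (p x y) ≤ m y * q x y - p x y := by
      intro x
      have h := mul_log_sub_mul_log_le_sub (hp x y) (mul_nonneg hm0 (hq x y).le)
        fun h => mul_pos (h.trans_le (hpm x)) (hq x y)
      rcases hm0.eq_or_lt with h0 | h0
      · have : p x y = 0 := le_antisymm (h0 ▸ hpm x) (hp x y)
        simp [this, ← h0]
      · rwa [Real.log_mul h0.ne' (hq x y).ne', mul_add] at h
    have h := Finset.sum_le_sum fun x (_ : x ∈ Finset.univ) => hterm x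
    rw [Finset.sum_sub_distrib, Finset.sum_add_distrib, ← Finset.sum_mul, hm,
      Finset.sum_sub_distrib, ← Finset.mul_sum, hm] at h
    have := mul_le_mul_of_nonneg_left (hsum y) hm0
    linarith
  have h := Finset.sum_nonpos fun y (_ : y ∈ Finset.univ) => key y
  rw [Finset.sum_sub_distrib, Finset.sum_add_distrib] at h
  change -∑ y, ∑ x, p x y * Real.log (p x y) ≤ -∑ y, m y * Real.log (m y)
    - ∑ y, ∑ x, p x y * Real.log (q x y)
  linarith

theorem shannonEntropy_eq_log_card {Ω α : Type*} [MeasurableSpace Ω] [Fintype α] [Nonempty α]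
    (μ : Measure Ω) {X : Ω → α}
    (h : ∀ x, μ.real (X ⁻¹' {x}) = (Fintype.card α : ℝ)⁻¹) :
    shannonEntropy μ X = Real.log (Fintype.card α) := by
  simp [shannonEntropy, ← measureReal_def, h]

/-- The conditional sub-probability on blocks under which each letter is kept with weight
`1 / 2` and replaced by any other given letter with weight `1 / (2 N)`. -/
noncomputable def fanoKernel {ι M : Type*} [Fintype ι] [Fintype M] (w v : ι → M) : ℝ :=
  open Classical in
  ∏ l, (2⁻¹ * if w l ≠ v l then (Fintype.card M : ℝ)⁻¹ else 1)

theorem fanoKernel_pos {ι M : Type*} [Fintype ι] [Fintype M] [Nonempty M] (w v : ι → M) :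
    0 < fanoKernel w v := by
  refine Finset.prod_pos fun l _ => ?_
  split_ifs <;> positivity

theorem sum_fanoKernel_le_one {ι M : Type*} [Fintype ι] [DecidableEq ι] [Fintype M] [Nonempty M]
    (v : ι → M) : ∑ w, fanoKernel w v ≤ 1 := by
  classical
  unfold fanoKernel
  rw [← Fintype.prod_sum fun l m => (2⁻¹ * if m ≠ v l then (Fintype.card M : ℝ)⁻¹ else 1)]
  refine Finset.prod_le_one (fun l _ => Finset.sum_nonneg fun m _ => by positivity)
    fun l _ => ?_
  rw [← Finset.mul_sum]
  have h : ∑ m, (if m ≠ v l then (Fintype.card M : ℝ)⁻¹ else 1)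
      ≤ ∑ m, ((Fintype.card M : ℝ)⁻¹ + if m = v l then 1 else 0) := by
    refine Finset.sum_le_sum fun m _ => ?_
    by_cases hm : m = v l <;> simp [hm]
  have h2 : ∑ m, ((Fintype.card M : ℝ)⁻¹ + if m = v l then 1 else 0) = 2 := by
    rw [Finset.sum_add_distrib]
    norm_num
  linarith

open Classical in
theorem log_fanoKernel {ι M : Type*} [Fintype ι] [Fintype M] [Nonempty M] (w v : ι → M) :
    Real.log (fanoKernel w v) = -(Fintype.card ι * Real.log 2)
      - ∑ l, (if w l ≠ v l then 1 else 0) * Real.log (Fintype.card M) := by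
  have hpos : ∀ l, (2⁻¹ * if w l ≠ v l then (Fintype.card M : ℝ)⁻¹ else 1) ≠ 0 := fun l => by
    split_ifs <;> positivity
  rw [fanoKernel, Real.log_prod fun l _ => hpos l]
  have : ∀ l, Real.log (2⁻¹ * if w l ≠ v l then (Fintype.card M : ℝ)⁻¹ else 1)
      = -Real.log 2 - (if w l ≠ v l then 1 else 0) * Real.log (Fintype.card M) := fun l => by
    split_ifs
    · rw [Real.log_mul (by positivity) (by positivity), Real.log_inv, Real.log_inv]
      ring
    · simp
  simp only [this, Finset.sum_sub_distrib, Finset.sum_const, Finset.card_univ, nsmul_eq_mul, mul_neg]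

/-- **Fano-type bound on the mutual information of an interleaved block.**
If `W = (W_1, ..., W_b)` has i.i.d. components uniform on a set `M` of size `Nc`, and
`Ŵ` is any estimate with `P(W_ℓ ≠ Ŵ_ℓ) ≤ ε` for each `ℓ`, then
`I(W; Ŵ) = H(W) + H(Ŵ) - H(W, Ŵ) ≥ b ((1 - ε) log Nc - log 2)`. -/
theorem stmt14 {Ω M : Type*} [MeasureSpace Ω] [IsProbabilityMeasure (ℙ : Measure Ω)]
    [MeasurableSpace M] [MeasurableSingletonClass M] [Fintype M]
    (Nc b : ℕ) (hN : 2 ≤ Nc) (hb : 1 ≤ b) (hcard : Fintype.card M = Nc)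
    (ε : ℝ) (hε : ε ∈ Set.Icc (0 : ℝ) 1)
    (W What : Ω → Fin b → M) (hW : Measurable W) (hWhat : Measurable What)
    (hunif : ∀ w : Fin b → M, ℙ {ω : Ω | W ω = w} = 1 / (Nc : ℝ≥0∞) ^ b)
    (herr : ∀ l : Fin b, ℙ {ω : Ω | W ω l ≠ What ω l} ≤ ENNReal.ofReal ε) :
    shannonEntropy ℙ W + shannonEntropy ℙ What
        - shannonEntropy ℙ (fun ω => (W ω, What ω))
      ≥ b * ((1 - ε) * Real.log Nc - Real.log 2) := by
  classical
  subst hcard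
  have : Nonempty M := Fintype.card_pos_iff.mp (by omega)
  have hpair : Measurable fun ω => (W ω, What ω) := hW.prodMk hWhat
  have hHW : shannonEntropy ℙ W = b * Real.log (Fintype.card M) := by
    rw [shannonEntropy_eq_log_card]
    · simp
    · intro w
      rw [measureReal_def, show W ⁻¹' {w} = {ω | W ω = w} from rfl, hunif]
      simp
  have herr' : ∀ l, (ℙ : Measure Ω).real {ω | W ω l ≠ What ω l} ≤ ε := fun l =>
    ENNReal.toReal_le_of_le_ofReal hε.1 (herr l)
  have hlog : 0 ≤ Real.log (Fintype.card M) := Real.log_natCast_nonneg _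
  have hfano := shannonEntropy_prodMk_le ℙ hW What fanoKernel fanoKernel_pos
    sum_fanoKernel_le_one
  have htotal : ∑ z, (ℙ : Measure Ω).real ((fun ω => (W ω, What ω)) ⁻¹' {z}) = 1 := by
    simpa using sum_indicator_mul_measureReal_preimage ℙ hpair fun _ => True
  have hexp : ∑ z : (Fin b → M) × (Fin b → M),
      (ℙ : Measure Ω).real ((fun ω => (W ω, What ω)) ⁻¹' {z}) * Real.log (fanoKernel z.1 z.2)
      = -(b * Real.log 2)
        - (∑ l, (ℙ : Measure Ω).real {ω | W ω l ≠ What ω l}) * Real.log (Fintype.card M) := by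
    simp only [log_fanoKernel, mul_sub, Finset.sum_sub_distrib, ← Finset.sum_mul, htotal,
      Fintype.card_fin, one_mul, ← mul_assoc]
    congr 2
    simp only [Finset.mul_sum]
    rw [Finset.sum_comm]
    exact Finset.sum_congr rfl fun l _ =>
      sum_indicator_mul_measureReal_preimage ℙ hpair fun z => z.1 l ≠ z.2 l
  have hsum : ∑ l, (ℙ : Measure Ω).real {ω | W ω l ≠ What ω l} ≤ b * ε := by
    simpa using Finset.sum_le_sum fun l (_ : l ∈ Finset.univ) => herr' l
  have := mul_le_mul_of_nonneg_right hsum hlog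
  rw [hexp] at hfano
  rw [hHW]
  linarith
end
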